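/- arXiv:2211.15715 — 2 statements merged into one kernel-verified Lean document; each statement's English description precedes it below -/
import Mathlib

section
/- For any integers 1 ≤ k ≤ d there exist constants c' ∈ (0,1] and C > 0 (depending only on d and k) such that for all integers n > k one has Δ'_{k,d}(n) ≤ C · Δ_{k,d}(⌈c'·n⌉). -/
open scoped RealInnerProductSpace

/-- The Gram matrix of a collection of `k` vectors in `ℝ^d`. -/
noncomputable def gram {d k : ℕ} (v : Fin k → EuclideanSpace ℝ (Fin d)) :
    Matrix (Fin k) (Fin k) ℝ :=
  Matrix.of fun i j => ⟪v i, v j⟫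

/-- `vol v` is the `k`-dimensional volume of the parallelepiped spanned by
`v 1, …, v k`, i.e. the square root of the determinant of their Gram matrix.
For `k = 0` it equals `1`. -/
noncomputable def vol {d k : ℕ} (v : Fin k → EuclideanSpace ℝ (Fin d)) : ℝ :=
  Real.sqrt (gram v).det

/-- The `k`-dimensional volume of the simplex with vertices `p 0, …, p k`. -/
noncomputable def simplexVol {d k : ℕ} (p : Fin (k + 1) → EuclideanSpace ℝ (Fin d)) : ℝ :=
  (Nat.factorial k : ℝ)⁻¹ * vol (fun i : Fin k => p i.succ - p 0)

/-- The minimum, over all `(k+1)`-element subsets of `X`, of the `k`-dimensional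
volume of the simplex they span. -/
noncomputable def minSimplexVol (d k : ℕ) (X : Finset (EuclideanSpace ℝ (Fin d))) : ℝ :=
  sInf { v : ℝ | ∃ p : Fin (k + 1) → EuclideanSpace ℝ (Fin d),
    Function.Injective p ∧ (∀ i, p i ∈ X) ∧ v = simplexVol p }

/-- `Delta k d n` is the supremum, over all `n`-element subsets `X` of the unit cube
`[0,1]^d`, of the minimum `k`-dimensional simplex volume among `(k+1)`-element
subsets of `X`. -/
noncomputable def Delta (k d n : ℕ) : ℝ :=
  sSup { v : ℝ | ∃ X : Finset (EuclideanSpace ℝ (Fin d)), X.card = n ∧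
    (∀ x ∈ X, ∀ i, x i ∈ Set.Icc (0 : ℝ) 1) ∧ v = minSimplexVol d k X }

/-- The minimum, over all `(k+1)`-element subsets of `X ⊆ ℝ^{d+1}`, of the
determinant (parallelepiped volume) of the `k+1` chosen vectors. -/
noncomputable def minDet (d k : ℕ) (X : Finset (EuclideanSpace ℝ (Fin (d + 1)))) : ℝ :=
  sInf { v : ℝ | ∃ p : Fin (k + 1) → EuclideanSpace ℝ (Fin (d + 1)),
    Function.Injective p ∧ (∀ i, p i ∈ X) ∧ v = vol p }

/-- `Delta' k d n` is the supremum, over all `n`-element sets `X` of unit vectors in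
`ℝ^{d+1}`, of the minimum determinant among `(k+1)`-element subsets of `X`. -/
noncomputable def Delta' (k d n : ℕ) : ℝ :=
  sSup { v : ℝ | ∃ X : Finset (EuclideanSpace ℝ (Fin (d + 1))), X.card = n ∧
    (∀ x ∈ X, ‖x‖ = 1) ∧ v = minDet d k X }

theorem vol_nonneg {d k : ℕ} (v : Fin k → EuclideanSpace ℝ (Fin d)) : 0 ≤ vol v :=
  Real.sqrt_nonneg _

theorem simplexVol_nonneg {d k : ℕ} (p : Fin (k + 1) → EuclideanSpace ℝ (Fin d)) :
    0 ≤ simplexVol p :=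
  mul_nonneg (by positivity) (vol_nonneg _)

theorem vol_smul {d k : ℕ} (a : Fin k → ℝ) (v : Fin k → EuclideanSpace ℝ (Fin d)) :
    vol (fun i => a i • v i) = |∏ i, a i| * vol v := by
  have h : gram (fun i => a i • v i) = Matrix.diagonal a * gram v * Matrix.diagonal a := by
    ext i j
    simp [gram, real_inner_smul_left, real_inner_smul_right]
    ring
  rw [vol, vol, h, Matrix.det_mul, Matrix.det_mul, Matrix.det_diagonal,
    ← Real.sqrt_sq_eq_abs, ← Real.sqrt_mul (sq_nonneg _)]
  ring_nf

/-- Adjoining a vector multiplies the Gram determinant by at most the squared norm. -/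
theorem det_gram_cons_le {d k : ℕ} (a : EuclideanSpace ℝ (Fin d))
    (b : Fin k → EuclideanSpace ℝ (Fin d)) :
    (gram (Fin.cons a b : Fin (k + 1) → EuclideanSpace ℝ (Fin d))).det
      ≤ ‖a‖ ^ 2 * (gram b).det := by
  set w : Fin (k + 1) → EuclideanSpace ℝ (Fin d) := Fin.cons a b with hw
  set M := gram w with hM
  set K := Submodule.span ℝ (Set.range b)
  let f : EuclideanSpace ℝ (Fin d) → ℝ := fun x => (M.updateRow 0 fun j => ⟪x, w j⟫).det
  have f_add (x y) : f (x + y) = f x + f y := by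
    have h : (fun j => ⟪x + y, w j⟫) = (fun j => ⟪x, w j⟫) + fun j => ⟪y, w j⟫ := by
      ext j
      simp [inner_add_left]
    simp only [f, h, Matrix.det_updateRow_add]
  have f_smul (c : ℝ) (x) : f (c • x) = c * f x := by
    have h : (fun j => ⟪c • x, w j⟫) = c • fun j => ⟪x, w j⟫ := by
      ext j
      simp [real_inner_smul_left]
    simp only [f, h, Matrix.det_updateRow_smul]
  have f_span (x) (hx : x ∈ K) : f x = 0 := by
    induction hx using Submodule.span_induction with
    | mem x hx =>
      obtain ⟨i, rfl⟩ := hx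
      refine Matrix.det_zero_of_row_eq (Fin.succ_ne_zero i).symm ?_
      ext j
      simp [hM, gram, hw]
    | zero => simpa using f_smul 0 0
    | add x y _ _ hx hy => rw [f_add, hx, hy, add_zero]
    | smul c x _ hx => rw [f_smul, hx, mul_zero]
  have hfa : f a = M.det := by
    have : (fun j => ⟪a, w j⟫) = M 0 := by ext j; simp [hM, gram, hw]
    simp only [f, this, Matrix.updateRow_eq_self]
  set a₂ := a - K.starProjection a with ha₂
  have horth : ∀ x ∈ K, ⟪a₂, x⟫ = 0 := fun x hx => K.starProjection_inner_eq_zero a x hx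
  have haa : ⟪a₂, a⟫ = ‖a₂‖ ^ 2 := by
    have h := horth _ (K.starProjection_apply_mem a)
    rw [← real_inner_self_eq_norm_sq, ← sub_eq_zero, ← inner_sub_right, ha₂, sub_sub_cancel]
    exact h
  have hfa₂ : f a₂ = ‖a₂‖ ^ 2 * (gram b).det := by
    have hsub : (M.updateRow 0 fun j => ⟪a₂, w j⟫).submatrix Fin.succ (Fin.succAbove 0) = gram b := by
      ext i j
      simp [hM, gram, hw, Matrix.updateRow_apply]
    simp only [f]
    rw [Matrix.det_succ_row_zero, Fin.sum_univ_succ, Finset.sum_eq_zero, hsub]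
    · simp [hw, haa]
    · intro i _
      simp [hw, horth (b i) (Submodule.subset_span ⟨i, rfl⟩)]
  have hle : ‖a₂‖ ≤ ‖a‖ := by
    have := real_inner_le_norm a₂ a
    rw [haa, sq] at this
    rcases (norm_nonneg a₂).eq_or_lt with h | h
    · rw [← h]; positivity
    · exact le_of_mul_le_mul_left this h
  have hsum : a = K.starProjection a + a₂ := by simp [ha₂]
  rw [← hfa, hsum, f_add, f_span _ (K.starProjection_apply_mem a), zero_add, hfa₂, ← hsum]
  have : 0 ≤ (gram b).det := (Matrix.posSemidef_gram ℝ b).det_nonneg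
  gcongr

theorem vol_le_norm_mul_vol_sub {d k : ℕ} (w : Fin (k + 1) → EuclideanSpace ℝ (Fin d)) :
    vol w ≤ ‖w 0‖ * vol fun i : Fin k => w i.succ - w 0 := by
  set b : Fin k → EuclideanSpace ℝ (Fin d) := fun i => w i.succ - w 0
  set w' : Fin (k + 1) → EuclideanSpace ℝ (Fin d) := Fin.cons (w 0) b with hw'
  let c : Fin (k + 1) → ℝ := Fin.cons 0 fun _ => 1
  have hc : ∀ i, w i = w' i + c i • w' 0 := by
    intro i
    refine Fin.cases ?_ (fun i => ?_) i <;> simp [w', c, b]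
  have h : (gram w).det = (gram w').det := by
    let B : Matrix (Fin (k + 1)) (Fin (k + 1)) ℝ := Matrix.of fun i j => ⟪w' i, w j⟫
    trans B.det
    · refine Matrix.det_eq_of_forall_row_eq_smul_add_const c 0 rfl fun i j => ?_
      simp only [gram, B, Matrix.of_apply]
      rw [hc i, inner_add_left, real_inner_smul_left]
    · rw [← Matrix.det_transpose B, ← Matrix.det_transpose (gram w')]
      refine Matrix.det_eq_of_forall_row_eq_smul_add_const c 0 rfl fun i j => ?_
      simp only [gram, B, Matrix.of_apply, Matrix.transpose_apply]
      rw [hc i, inner_add_right, real_inner_smul_right]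
  rw [vol, vol, h, ← Real.sqrt_sq (norm_nonneg (w 0)), ← Real.sqrt_mul (sq_nonneg _)]
  exact Real.sqrt_le_sqrt (det_gram_cons_le _ _)

theorem linearIndependent_of_vol_ne_zero {d k : ℕ} {v : Fin k → EuclideanSpace ℝ (Fin d)}
    (h : vol v ≠ 0) : LinearIndependent ℝ v :=
  Matrix.linearIndependent_of_det_gram_ne_zero fun h' : (gram v).det = 0 => h (by simp [vol, h'])

/-- Finitely many unit vectors such that each unit vector is almost orthogonal to at most `d`
of them. -/
theorem exists_unit_vectors_card_near_orthogonal_le (d N : ℕ) :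
    ∃ (U : Fin N → EuclideanSpace ℝ (Fin (d + 1))) (c : ℝ), 0 < c ∧ (∀ j, ‖U j‖ = 1) ∧
      ∀ v, ‖v‖ = 1 → (Finset.univ.filter fun j => |⟪U j, v⟫| < c).card ≤ d := by
  let P : Fin N → EuclideanSpace ℝ (Fin (d + 1)) :=
    fun j => WithLp.toLp 2 fun i => (j : ℝ) ^ (i : ℕ)
  have hP (j) : P j ≠ 0 := by
    intro h
    have := congrArg (fun x => x 0) h
    simp [P] at this
  let U : Fin N → EuclideanSpace ℝ (Fin (d + 1)) := fun j => ‖P j‖⁻¹ • P j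
  have key (S : Finset (Fin N)) (hS : S.card = d + 1) :
      ∃ c : ℝ, 0 < c ∧ ∀ v : EuclideanSpace ℝ (Fin (d + 1)), ‖v‖ = 1 →
        c ≤ ∑ j ∈ S, |⟪U j, v⟫| := by
    obtain ⟨v₀, hv₀, hmin⟩ := (isCompact_sphere (0 : EuclideanSpace ℝ (Fin (d + 1))) 1).exists_isMinOn
      ((NormedSpace.sphere_nonempty (x := (0 : EuclideanSpace ℝ (Fin (d + 1)))) (r := 1)).2 zero_le_one)
      (f := fun v => ∑ j ∈ S, |⟪U j, v⟫|) (by fun_prop)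
    refine ⟨_, ?_, fun v hv => hmin (by simpa using hv)⟩
    refine (Finset.sum_nonneg fun _ _ => abs_nonneg _).lt_of_ne' fun h => ?_
    rw [Finset.sum_eq_zero_iff_of_nonneg fun _ _ => abs_nonneg _] at h
    let e := S.orderEmbOfFin hS
    have hzero : (v₀.ofLp : Fin (d + 1) → ℝ) = 0 := by
      refine Matrix.eq_zero_of_forall_index_sum_pow_mul_eq_zero
        (f := fun i => ((e i : Fin N) : ℝ)) (fun i j hij => e.injective ?_) fun i => ?_
      · exact Fin.ext (Nat.cast_injective (R := ℝ) hij)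
      · have h0 : ⟪P (e i), v₀⟫ = 0 := by
          simpa [U, real_inner_smul_left, hP] using h (e i) (S.orderEmbOfFin_mem hS i)
        simpa [PiLp.inner_apply, P, mul_comm] using h0
    have : v₀ = 0 := by ext i; simp [hzero]
    simp [this] at hv₀
  have hev : ∀ᶠ c : ℝ in nhdsWithin 0 (Set.Ioi 0), ∀ S : Finset (Fin N), S.card = d + 1 →
      ∀ v : EuclideanSpace ℝ (Fin (d + 1)), ‖v‖ = 1 → c * (d + 1) ≤ ∑ j ∈ S, |⟪U j, v⟫| := by
    refine Filter.eventually_all.2 fun S => ?_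
    by_cases hS : S.card = d + 1
    · obtain ⟨c, hc, h⟩ := key S hS
      filter_upwards [Ioo_mem_nhdsGT (show (0 : ℝ) < c / (d + 1) by positivity)] with x hx _ v hv
      have := (lt_div_iff₀ (by positivity)).1 hx.2
      linarith [h v hv]
    · simp [hS]
  obtain ⟨c, h, hc⟩ := (hev.and self_mem_nhdsWithin).exists
  refine ⟨U, c, hc, fun j => by simp [U, norm_smul, hP], fun v hv => ?_⟩
  by_contra! hcard
  obtain ⟨S, hS, hScard⟩ := Finset.exists_subset_card_eq hcard
  have h1 := h S hScard v hv
  have h2 : ∑ j ∈ S, |⟪U j, v⟫| < ∑ j ∈ S, c := by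
    refine Finset.sum_lt_sum_of_nonempty (Finset.card_pos.1 (by omega)) fun j hj => ?_
    exact (Finset.mem_filter.1 (hS hj)).2
  simp [hScard] at h2
  linarith

/-- Some direction from the family is almost orthogonal to few vectors of a given finite set. -/
theorem exists_card_near_orthogonal_le {d m : ℕ} (hN : 0 < d * m)
    {U : Fin (d * m) → EuclideanSpace ℝ (Fin (d + 1))} {c : ℝ}
    (hU : ∀ v, ‖v‖ = 1 → (Finset.univ.filter fun j => |⟪U j, v⟫| < c).card ≤ d)
    (X : Finset (EuclideanSpace ℝ (Fin (d + 1)))) (hX : ∀ x ∈ X, ‖x‖ = 1) :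
    ∃ j, m * (X.filter fun x => |⟪U j, x⟫| < c).card ≤ X.card := by
  by_contra! h
  have h1 : ∑ j : Fin (d * m), (X.filter fun x => |⟪U j, x⟫| < c).card ≤ d * X.card := by
    refine le_trans (le_of_eq ?_) ((Finset.sum_le_card_nsmul X _ d fun x hx =>
      hU x (hX x hx)).trans_eq (mul_comm _ _))
    exact Finset.sum_card_bipartiteAbove_eq_sum_card_bipartiteBelow (fun j x => |⟪U j, x⟫| < c)
  have h2 : ∑ j : Fin (d * m), X.card
      < ∑ j : Fin (d * m), m * (X.filter fun x => |⟪U j, x⟫| < c).card :=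
    Finset.sum_lt_sum_of_nonempty ⟨⟨0, by omega⟩, Finset.mem_univ _⟩ fun j _ => h j
  rw [← Finset.mul_sum] at h2
  simp only [Finset.sum_const, Finset.card_univ, Fintype.card_fin, smul_eq_mul] at h2
  have := Nat.mul_le_mul_left m h1
  nlinarith

/-- Orthogonal projection along a unit vector, in coordinates. -/
theorem exists_linearMap_inner_eq {d : ℕ} (u : EuclideanSpace ℝ (Fin (d + 1))) (hu : ‖u‖ = 1) :
    ∃ T : EuclideanSpace ℝ (Fin (d + 1)) →ₗ[ℝ] EuclideanSpace ℝ (Fin d),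
      ∀ x y, ⟪T x, T y⟫ = ⟪x, y⟫ - ⟪u, x⟫ * ⟪u, y⟫ := by
  have hu0 : u ≠ 0 := by rintro rfl; simp at hu
  have : Fact (Module.finrank ℝ (EuclideanSpace ℝ (Fin (d + 1))) = d + 1) := ⟨by simp⟩
  let B := OrthonormalBasis.fromOrthogonalSpanSingleton (𝕜 := ℝ) d hu0
  refine ⟨B.repr.toLinearEquiv.toLinearMap ∘ₗ
    ((Submodule.span ℝ {u})ᗮ.orthogonalProjectionOnto).toLinearMap, fun x y => ?_⟩
  have hproj (x) : ((Submodule.span ℝ {u})ᗮ.orthogonalProjectionOnto x : EuclideanSpace ℝ (Fin (d + 1)))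
      = x - ⟪u, x⟫ • u := by
    rw [← Submodule.starProjection_apply, Submodule.starProjection_orthogonal_val,
      Submodule.starProjection_unit_singleton ℝ hu]
  have huu : ⟪u, u⟫ = 1 := by rw [real_inner_self_eq_norm_sq, hu]; norm_num
  simp only [LinearMap.comp_apply, LinearEquiv.coe_coe, LinearIsometryEquiv.coe_toLinearEquiv,
    LinearIsometryEquiv.inner_map_map, ContinuousLinearMap.coe_coe, Submodule.coe_inner, hproj,
    inner_sub_left, inner_sub_right, real_inner_smul_left, real_inner_smul_right, huu,
    real_inner_comm u x]
  ring

/-- Central projection from the origin to the hyperplane `⟪u, x⟫ = 1`, followed by coordinates `T`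
on that hyperplane and a rescaling by `c / 2` around the centre of the unit cube. -/
noncomputable def centralChart {d : ℕ} (u : EuclideanSpace ℝ (Fin (d + 1)))
    (T : EuclideanSpace ℝ (Fin (d + 1)) →ₗ[ℝ] EuclideanSpace ℝ (Fin d)) (c : ℝ)
    (v : EuclideanSpace ℝ (Fin (d + 1))) : EuclideanSpace ℝ (Fin d) :=
  (c / 2) • T (⟪u, v⟫⁻¹ • v) + WithLp.toLp 2 fun _ => 1 / 2

section centralChart

variable {d : ℕ} {u : EuclideanSpace ℝ (Fin (d + 1))}
  {T : EuclideanSpace ℝ (Fin (d + 1)) →ₗ[ℝ] EuclideanSpace ℝ (Fin d)} {c : ℝ}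

theorem centralChart_mem_Icc (hT : ∀ x y, ⟪T x, T y⟫ = ⟪x, y⟫ - ⟪u, x⟫ * ⟪u, y⟫) (hc : 0 < c)
    {v : EuclideanSpace ℝ (Fin (d + 1))} (hv : ‖v‖ = 1) (hcv : c ≤ |⟪u, v⟫|) (i : Fin d) :
    centralChart u T c v i ∈ Set.Icc (0 : ℝ) 1 := by
  set w := ⟪u, v⟫⁻¹ • v with hw
  have hT1 : ‖T w‖ ≤ ‖w‖ := by
    refine (pow_le_pow_iff_left₀ (norm_nonneg _) (norm_nonneg _) two_ne_zero).1 ?_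
    rw [← real_inner_self_eq_norm_sq, ← real_inner_self_eq_norm_sq, hT]
    nlinarith [mul_self_nonneg ⟪u, w⟫]
  have hw1 : ‖w‖ ≤ c⁻¹ := by
    rw [hw, norm_smul, hv, mul_one, norm_inv, Real.norm_eq_abs]
    exact inv_anti₀ hc hcv
  have h : |c * T w i| ≤ 1 := by
    rw [abs_mul, abs_of_pos hc, ← mul_inv_cancel₀ hc.ne']
    gcongr
    exact (PiLp.norm_apply_le (T w) i).trans (hT1.trans hw1)
  have hval : centralChart u T c v i = (c * T w i + 1) / 2 := by
    simp [centralChart, hw]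
    ring
  rw [hval]
  constructor <;> linarith [abs_le.1 h]

theorem smul_eq_smul_of_centralChart_eq
    (hT : ∀ x y, ⟪T x, T y⟫ = ⟪x, y⟫ - ⟪u, x⟫ * ⟪u, y⟫) (hc : 0 < c)
    {v v' : EuclideanSpace ℝ (Fin (d + 1))} (hv : ⟪u, v⟫ ≠ 0) (hv' : ⟪u, v'⟫ ≠ 0)
    (h : centralChart u T c v = centralChart u T c v') : ⟪u, v⟫⁻¹ • v = ⟪u, v'⟫⁻¹ • v' := by
  have h1 : T (⟪u, v⟫⁻¹ • v - ⟪u, v'⟫⁻¹ • v') = 0 := by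
    rw [map_sub, sub_eq_zero]
    exact smul_right_injective _ (half_pos hc).ne' (add_right_cancel h)
  have h2 : ⟪u, ⟪u, v⟫⁻¹ • v - ⟪u, v'⟫⁻¹ • v'⟫ = 0 := by
    simp [inner_sub_right, real_inner_smul_right, hv, hv']
  have h3 := hT (⟪u, v⟫⁻¹ • v - ⟪u, v'⟫⁻¹ • v') (⟪u, v⟫⁻¹ • v - ⟪u, v'⟫⁻¹ • v')
  rw [h1, h2, inner_zero_left, mul_zero, sub_zero] at h3
  exact sub_eq_zero.1 (inner_self_eq_zero.1 h3.symm)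

theorem vol_le_mul_simplexVol_centralChart {k : ℕ} (hu : ‖u‖ = 1)
    (hT : ∀ x y, ⟪T x, T y⟫ = ⟪x, y⟫ - ⟪u, x⟫ * ⟪u, y⟫) (hc : 0 < c)
    {p : Fin (k + 1) → EuclideanSpace ℝ (Fin (d + 1))} (hp : ∀ i, ‖p i‖ = 1)
    (hcp : ∀ i, c ≤ |⟪u, p i⟫|) :
    vol p ≤ c⁻¹ * (2 / c) ^ k * k.factorial * simplexVol fun i => centralChart u T c (p i) := by
  set a : Fin (k + 1) → ℝ := fun i => ⟪u, p i⟫ with ha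
  set w : Fin (k + 1) → EuclideanSpace ℝ (Fin (d + 1)) := fun i => (a i)⁻¹ • p i with hw
  have ha0 (i) : a i ≠ 0 := abs_pos.1 (hc.trans_le (hcp i))
  have ha1 (i) : |a i| ≤ 1 := by simpa [hu, hp] using abs_real_inner_le_norm u (p i)
  have hvol : vol p ≤ vol w := by
    have hpw : p = fun i => a i • w i := by
      ext1 i
      simp [hw, smul_smul, ha0 i]
    rw [hpw, vol_smul, Finset.abs_prod]
    exact mul_le_of_le_one_left (vol_nonneg _)
      (Finset.prod_le_one (fun _ _ => abs_nonneg _) fun i _ => ha1 i)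
  have hw0 : ‖w 0‖ ≤ c⁻¹ := by
    rw [hw, norm_smul, hp, mul_one, norm_inv, Real.norm_eq_abs]
    exact inv_anti₀ hc (hcp 0)
  have hsub (i) : ⟪u, w i - w 0⟫ = 0 := by
    have h (i) : ⟪u, w i⟫ = 1 := by
      rw [hw, real_inner_smul_right]
      exact inv_mul_cancel₀ (ha0 i)
    rw [inner_sub_right, h, h, sub_self]
  have hTvol : vol (fun i : Fin k => T (w i.succ - w 0)) = vol fun i : Fin k => w i.succ - w 0 := by
    simp only [vol, gram, hT, hsub, mul_zero, sub_zero]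
  have hchart : simplexVol (fun i => centralChart u T c (p i))
      = (k.factorial : ℝ)⁻¹ * ((c / 2) ^ k * vol fun i : Fin k => w i.succ - w 0) := by
    have h : (fun i : Fin k => centralChart u T c (p i.succ) - centralChart u T c (p 0))
        = fun i => (c / 2) • T (w i.succ - w 0) := by
      ext1 i
      rw [centralChart, centralChart, add_sub_add_right_eq_sub, ← smul_sub, ← map_sub]
    rw [simplexVol, h, vol_smul (fun _ => c / 2) fun i : Fin k => T (w i.succ - w 0), hTvol,
      Finset.prod_const, Finset.card_univ, Fintype.card_fin, abs_of_pos (by positivity)]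
  calc vol p ≤ vol w := hvol
    _ ≤ ‖w 0‖ * vol fun i : Fin k => w i.succ - w 0 := vol_le_norm_mul_vol_sub w
    _ ≤ c⁻¹ * vol fun i : Fin k => w i.succ - w 0 :=
      mul_le_mul_of_nonneg_right hw0 (vol_nonneg _)
    _ = _ := by
      rw [hchart, div_pow, div_pow]
      have := Nat.factorial_ne_zero k
      field_simp

end centralChart

theorem minDet_le_vol {d k : ℕ} {X : Finset (EuclideanSpace ℝ (Fin (d + 1)))}
    {p : Fin (k + 1) → EuclideanSpace ℝ (Fin (d + 1))} (hp : Function.Injective p)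
    (hpX : ∀ i, p i ∈ X) : minDet d k X ≤ vol p :=
  csInf_le ⟨0, by rintro _ ⟨p, -, -, rfl⟩; exact vol_nonneg p⟩ ⟨p, hp, hpX, rfl⟩

theorem minSimplexVol_nonneg {d k : ℕ} (X : Finset (EuclideanSpace ℝ (Fin d))) :
    0 ≤ minSimplexVol d k X :=
  Real.sInf_nonneg (by rintro _ ⟨p, -, -, rfl⟩; exact simplexVol_nonneg p)

theorem Delta_nonneg (k d n : ℕ) : 0 ≤ Delta k d n :=
  Real.sSup_nonneg (by rintro _ ⟨X, -, -, rfl⟩; exact minSimplexVol_nonneg X)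

theorem simplexVol_le_of_mem_cube {d k : ℕ} {p : Fin (k + 1) → EuclideanSpace ℝ (Fin d)}
    (hp : ∀ i j, p i j ∈ Set.Icc (0 : ℝ) 1) :
    simplexVol p ≤ (k.factorial : ℝ)⁻¹ * √(k.factorial * (d : ℝ) ^ k) := by
  have hdet := Matrix.det_le (A := gram fun i : Fin k => p i.succ - p 0)
    (abv := AbsoluteValue.abs) (x := (d : ℝ)) fun i j => by
      have hle : ∑ l : Fin d, |(p j.succ - p 0) l * (p i.succ - p 0) l| ≤ ∑ l : Fin d, (1 : ℝ) := by
        refine Finset.sum_le_sum fun l _ => ?_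
        rw [abs_mul]
        have h (i : Fin (k + 1)) : |(p i - p 0) l| ≤ 1 := by
          rw [PiLp.sub_apply, abs_le]
          constructor <;> linarith [(hp i l).1, (hp i l).2, (hp 0 l).1, (hp 0 l).2]
        exact mul_le_one₀ (h _) (abs_nonneg _) (h _)
      simp only [gram, Matrix.of_apply, PiLp.inner_apply]
      exact (Finset.abs_sum_le_sum_abs _ _).trans (hle.trans (by simp))
  rw [simplexVol, vol]
  gcongr
  simpa using (le_abs_self _).trans hdet

theorem minSimplexVol_le_Delta {d k : ℕ} {X : Finset (EuclideanSpace ℝ (Fin d))}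
    (hX : ∀ x ∈ X, ∀ i, x i ∈ Set.Icc (0 : ℝ) 1) : minSimplexVol d k X ≤ Delta k d X.card := by
  refine le_csSup ⟨(k.factorial : ℝ)⁻¹ * √(k.factorial * (d : ℝ) ^ k), ?_⟩ ⟨X, rfl, hX, rfl⟩
  rintro _ ⟨Y, -, hY, rfl⟩
  rcases Set.eq_empty_or_nonempty { v : ℝ | ∃ p : Fin (k + 1) → EuclideanSpace ℝ (Fin d),
    Function.Injective p ∧ (∀ i, p i ∈ Y) ∧ v = simplexVol p } with h | ⟨_, p, hp, hpY, rfl⟩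
  · rw [minSimplexVol, h, Real.sInf_empty]
    positivity
  · refine le_trans (csInf_le ⟨0, ?_⟩ ⟨p, hp, hpY, rfl⟩)
      (simplexVol_le_of_mem_cube fun i => hY _ (hpY i))
    rintro _ ⟨p, -, -, rfl⟩
    exact simplexVol_nonneg p

theorem linearIndependent_pair_of_minDet_pos {d k : ℕ} (hk : 1 ≤ k)
    {X : Finset (EuclideanSpace ℝ (Fin (d + 1)))} (hX : k < X.card) (hpos : 0 < minDet d k X)
    {v v' : EuclideanSpace ℝ (Fin (d + 1))} (hv : v ∈ X) (hv' : v' ∈ X) (hne : v ≠ v') :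
    LinearIndependent ℝ ![v, v'] := by
  obtain ⟨S, hS, hSX, hcard⟩ := Finset.exists_subsuperset_card_eq (s := {v, v'}) (t := X)
    (n := k + 1) (by simp [Finset.insert_subset_iff, hv, hv'])
    (by rw [Finset.card_pair hne]; omega) hX
  let e := S.equivFinOfCardEq hcard
  have hlin := linearIndependent_of_vol_ne_zero (hpos.trans_le (minDet_le_vol
    (p := fun i => (e.symm i : EuclideanSpace ℝ (Fin (d + 1))))
    (Subtype.val_injective.comp e.symm.injective) fun i => hSX (e.symm i).2)).ne'
  have hvS : v ∈ S := hS (by simp)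
  have hvS' : v' ∈ S := hS (by simp)
  have hcomp := hlin.comp ![e ⟨v, hvS⟩, e ⟨v', hvS'⟩] (by
    intro i j
    fin_cases i <;> fin_cases j <;> simp [hne, hne.symm])
  convert hcomp using 1
  ext1 i
  fin_cases i <;> simp

theorem minDet_le_mul_Delta {d k m : ℕ} (hk : 1 ≤ k) (hm : k < m) {c : ℝ} (hc : 0 < c)
    {u : EuclideanSpace ℝ (Fin (d + 1))} (hu : ‖u‖ = 1)
    {X : Finset (EuclideanSpace ℝ (Fin (d + 1)))} (hX : ∀ x ∈ X, ‖x‖ = 1)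
    (hcard : m ≤ (X.filter fun x => c ≤ |⟪u, x⟫|).card) :
    minDet d k X ≤ c⁻¹ * (2 / c) ^ k * k.factorial * Delta k d m := by
  classical
  rcases le_or_gt (minDet d k X) 0 with h0 | hpos
  · exact h0.trans (mul_nonneg (by positivity) (Delta_nonneg _ _ _))
  obtain ⟨T, hT⟩ := exists_linearMap_inner_eq u hu
  obtain ⟨Y, hY, rfl⟩ := Finset.exists_subset_card_eq hcard
  have hYX {x} (hx : x ∈ Y) : x ∈ X := (Finset.mem_filter.1 (hY hx)).1
  have hYc {x} (hx : x ∈ Y) : c ≤ |⟪u, x⟫| := (Finset.mem_filter.1 (hY hx)).2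
  have hY0 {x} (hx : x ∈ Y) : ⟪u, x⟫ ≠ 0 := abs_pos.1 (hc.trans_le (hYc hx))
  have hinj : Set.InjOn (centralChart u T c) Y := by
    intro v hv v' hv' hvv'
    by_contra hne
    have hpar := smul_eq_smul_of_centralChart_eq hT hc (hY0 hv) (hY0 hv') hvv'
    have hlin := linearIndependent_pair_of_minDet_pos hk
      (hm.trans_le (Finset.card_le_card fun _ => hYX)) hpos (hYX hv) (hYX hv') hne
    refine inv_ne_zero (hY0 hv) (LinearIndependent.pair_iff.1 hlin _ (-⟪u, v'⟫⁻¹) ?_).1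
    rw [neg_smul, hpar, add_neg_cancel]
  have hmin : minDet d k X / (c⁻¹ * (2 / c) ^ k * k.factorial)
      ≤ minSimplexVol d k (Y.image (centralChart u T c)) := by
    refine le_csInf ?_ ?_
    · let e := (Fin.castLEEmb (Nat.succ_le_of_lt hm)).trans
        (Y.equivFin.symm.toEmbedding.trans (Function.Embedding.subtype _))
      have he (i) : e i ∈ Y := (Y.equivFin.symm _).2
      exact ⟨_, fun i => centralChart u T c (e i),
        fun i j hij => e.injective (hinj (he i) (he j) hij),
        fun i => Finset.mem_image_of_mem _ (he i), rfl⟩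
    · rintro _ ⟨p, hp, hpY, rfl⟩
      choose p' hp'Y hp' using fun i => Finset.mem_image.1 (hpY i)
      rw [div_le_iff₀' (by positivity)]
      have hp'inj : Function.Injective p' := fun i j hij => hp (by rw [← hp', ← hp', hij])
      have := vol_le_mul_simplexVol_centralChart hu hT hc (fun i => hX _ (hYX (hp'Y i)))
        fun i => hYc (hp'Y i)
      simp only [hp'] at this
      exact (minDet_le_vol hp'inj fun i => hYX (hp'Y i)).trans this
  rw [div_le_iff₀' (by positivity)] at hmin
  refine hmin.trans ?_
  gcongr
  rw [← Finset.card_image_of_injOn hinj]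
  refine minSimplexVol_le_Delta fun x hx i => ?_
  obtain ⟨v, hv, rfl⟩ := Finset.mem_image.1 hx
  exact centralChart_mem_Icc hT hc (hX v (hYX hv)) (hYc hv) i

/-- **Proposition 2 (second inequality of the reduction).** For `1 ≤ k ≤ d` there are
constants `c' ∈ (0,1]` and `C > 0` (depending only on `d` and `k`) such that for all
`n > k`, `Δ'_{k,d}(n) ≤ C · Δ_{k,d}(⌈c'·n⌉)`. -/
theorem reduction_upper (k d : ℕ) (hk : 1 ≤ k) (hkd : k ≤ d) :
    ∃ c' C : ℝ, 0 < c' ∧ c' ≤ 1 ∧ 0 < C ∧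
      ∀ n : ℕ, k < n → Delta' k d n ≤ C * Delta k d ⌈c' * (n : ℝ)⌉₊ := by
  obtain ⟨U, c, hc, hU, hcount⟩ := exists_unit_vectors_card_near_orthogonal_le d (d * (k + 2))
  have hk2 : (0 : ℝ) < k + 2 := by positivity
  refine ⟨(k + 1) / (k + 2), c⁻¹ * (2 / c) ^ k * k.factorial, by positivity,
    (div_le_one hk2).2 (by linarith), by positivity, fun n hn => ?_⟩
  refine Real.sSup_le ?_ (mul_nonneg (by positivity) (Delta_nonneg _ _ _))
  rintro _ ⟨X, rfl, hX, rfl⟩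
  obtain ⟨j, hj⟩ := exists_card_near_orthogonal_le (Nat.mul_pos (by omega) (by omega)) hcount X hX
  refine minDet_le_mul_Delta hk ?_ hc (hU j) hX ?_
  · rw [Nat.lt_ceil, div_mul_eq_mul_div, lt_div_iff₀ hk2]
    have : (k : ℝ) + 1 ≤ X.card := by exact_mod_cast hn
    nlinarith
  · have hsplit := X.card_filter_add_card_filter_not fun x => |⟪U j, x⟫| < c
    simp only [not_lt] at hsplit
    rw [Nat.ceil_le, div_mul_eq_mul_div, div_le_iff₀ hk2]
    have h1 : ((k : ℝ) + 2) * (X.filter fun x => |⟪U j, x⟫| < c).card ≤ X.card := by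
      exact_mod_cast hj
    have h2 : ((X.filter fun x => |⟪U j, x⟫| < c).card : ℝ)
        + (X.filter fun x => c ≤ |⟪U j, x⟫|).card = X.card := by
      exact_mod_cast hsplit
    rw [← h2] at h1 ⊢
    linarith
end

section
/- There exists a constant C > 0 such that for every integer n ≥ 5 one has Δ_{4,4}(n) ≤ C · n^{−3/2}; equivalently, every n-element subset of [0,1]^4 contains 5 points spanning a 4-dimensional simplex of volume at most C · n^{−3/2}. -/
open scoped RealInnerProductSpace

/-- The volume spanned by `d` vectors in `ℝ^d` is the absolute value of the determinant of their
coordinates in an orthonormal basis. -/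
theorem vol_eq_abs_det {d : ℕ} (e : OrthonormalBasis (Fin d) ℝ (EuclideanSpace ℝ (Fin d)))
    (v : Fin d → EuclideanSpace ℝ (Fin d)) :
    vol v = |(Matrix.of fun i j => ⟪v i, e j⟫ : Matrix (Fin d) (Fin d) ℝ).det| := by
  set M : Matrix (Fin d) (Fin d) ℝ := Matrix.of fun i j => ⟪v i, e j⟫ with hM
  have h : gram v = M * M.transpose := by
    ext i j
    simp only [gram, Matrix.of_apply, Matrix.mul_apply, Matrix.transpose_apply, hM]
    rw [← e.sum_inner_mul_inner]
    exact Finset.sum_congr rfl fun k _ => by rw [real_inner_comm (v j)]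
  rw [vol, h, Matrix.det_mul, Matrix.det_transpose, ← sq, Real.sqrt_sq_eq_abs]

/-- A base pair `u, w` in `ℝ⁴` can be completed by two unit directions in such a way that
the volume spanned together with any `y, z` is at most the product of `‖u‖ * ‖w‖` with the area
spanned by the coordinates of `y, z` in these directions. -/
theorem exists_vol_le_norm_mul_norm_mul (u w : EuclideanSpace ℝ (Fin 4)) :
    ∃ a b : EuclideanSpace ℝ (Fin 4), ‖a‖ = 1 ∧ ‖b‖ = 1 ∧ ∀ y z,
      vol ![u, w, y, z] ≤ ‖u‖ * ‖w‖ * |⟪y, a⟫ * ⟪z, b⟫ - ⟪y, b⟫ * ⟪z, a⟫| := by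
  have hcard : Module.finrank ℝ (EuclideanSpace ℝ (Fin 4)) = Fintype.card (Fin 4) := by simp
  set e := InnerProductSpace.gramSchmidtOrthonormalBasis hcard ![u, w, 0, 0] with he
  have tri : ∀ i j : Fin 4, i < j → ⟪(![u, w, 0, 0] : Fin 4 → _) i, e j⟫ = 0 := fun i j hij => by
    rw [real_inner_comm]
    exact InnerProductSpace.gramSchmidtOrthonormalBasis_inv_triangular hcard _ hij
  have h01 : ⟪u, e 1⟫ = 0 := tri 0 1 (by decide)
  have h02 : ⟪u, e 2⟫ = 0 := tri 0 2 (by decide)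
  have h03 : ⟪u, e 3⟫ = 0 := tri 0 3 (by decide)
  have h12 : ⟪w, e 2⟫ = 0 := tri 1 2 (by decide)
  have h13 : ⟪w, e 3⟫ = 0 := tri 1 3 (by decide)
  refine ⟨e 2, e 3, e.orthonormal.1 2, e.orthonormal.1 3, fun y z => ?_⟩
  have hdet : (Matrix.of fun i j => ⟪(![u, w, y, z] : Fin 4 → _) i, e j⟫ :
      Matrix (Fin 4) (Fin 4) ℝ).det =
      ⟪u, e 0⟫ * ⟪w, e 1⟫ * (⟪y, e 2⟫ * ⟪z, e 3⟫ - ⟪y, e 3⟫ * ⟪z, e 2⟫) := by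
    rw [Matrix.det_succ_row_zero]
    simp [Fin.sum_univ_succ, Matrix.det_fin_three, Fin.succAbove, h01, h02, h03, h12, h13]
    ring
  have hu : |⟪u, e 0⟫| ≤ ‖u‖ := by simpa using abs_real_inner_le_norm u (e 0)
  have hw : |⟪w, e 1⟫| ≤ ‖w‖ := by simpa using abs_real_inner_le_norm w (e 1)
  rw [vol_eq_abs_det e, hdet, abs_mul, abs_mul]
  gcongr

theorem exists_nat_lt_mem_Icc_div {m : ℕ} (hm : 0 < m) {t : ℝ} (ht : t ∈ Set.Icc (0 : ℝ) 1) :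
    ∃ k < m, t ∈ Set.Icc ((k : ℝ) / m) ((k + 1) / m) := by
  have hm' : (0 : ℝ) < m := by exact_mod_cast hm
  rcases ht.2.lt_or_eq with h | rfl
  · refine ⟨⌊t * m⌋₊, ?_, ?_, ?_⟩
    · rw [Nat.floor_lt (mul_nonneg ht.1 hm'.le)]
      nlinarith
    · rw [div_le_iff₀ hm']
      exact Nat.floor_le (mul_nonneg ht.1 hm'.le)
    · rw [le_div_iff₀ hm']
      exact (Nat.lt_floor_add_one _).le
  · have h1 : ((m - 1 : ℕ) : ℝ) = m - 1 := by rw [Nat.cast_sub hm, Nat.cast_one]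
    refine ⟨m - 1, by omega, ?_, ?_⟩
    · rw [div_le_iff₀ hm', h1]
      linarith
    · rw [le_div_iff₀ hm', h1]
      linarith

theorem abs_sub_le_of_mem_Icc_div {k m s t : ℝ} (hs : s ∈ Set.Icc (k / m) ((k + 1) / m))
    (ht : t ∈ Set.Icc (k / m) ((k + 1) / m)) : |s - t| ≤ 1 / m := by
  have h := abs_sub_le_of_le_of_le hs.1 hs.2 ht.1 ht.2
  rwa [← sub_div, add_sub_cancel_left] at h

/-- Three of more than `2 * m ^ 4` points of the unit cube in `ℝ⁴` lie in a cube of side `1 / m`. -/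
theorem exists_three_close {m : ℕ} (hm : 0 < m) {X : Finset (EuclideanSpace ℝ (Fin 4))}
    (hX : ∀ x ∈ X, ∀ i, x i ∈ Set.Icc (0 : ℝ) 1) (hcard : 2 * m ^ 4 < X.card) :
    ∃ x ∈ X, ∃ y ∈ X, ∃ z ∈ X, x ≠ y ∧ x ≠ z ∧ y ≠ z ∧
      (∀ i, |y i - x i| ≤ 1 / m) ∧ ∀ i, |z i - x i| ≤ 1 / m := by
  classical
  have key : ∀ x : EuclideanSpace ℝ (Fin 4), ∃ f : Fin 4 → ℕ, x ∈ X → ∀ i, f i < m ∧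
      x i ∈ Set.Icc ((f i : ℝ) / m) ((f i + 1) / m) := fun x => by
    by_cases hx : x ∈ X
    · choose f hf using fun i => exists_nat_lt_mem_Icc_div hm (hX x hx i)
      exact ⟨f, fun _ => hf⟩
    · exact ⟨0, fun h => absurd h hx⟩
  choose f hf using key
  obtain ⟨c, -, hc⟩ := Finset.exists_lt_card_fiber_of_mul_lt_card_of_maps_to
    (s := X) (t := Fintype.piFinset fun _ : Fin 4 => Finset.range m) (f := f) (n := 2)
    (fun x hx => by simpa using fun i => (hf x hx i).1)
    (by simpa [mul_comm] using hcard)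
  obtain ⟨x, y, z, hx, hy, hz, hxy, hxz, hyz⟩ := Finset.two_lt_card_iff.1 hc
  simp only [Finset.mem_filter] at hx hy hz
  have close : ∀ p q, (p ∈ X ∧ f p = c) → (q ∈ X ∧ f q = c) → ∀ i, |p i - q i| ≤ 1 / m :=
    fun p q hp hq i => by
      have h1 := (hf p hp.1 i).2
      have h2 := (hf q hq.1 i).2
      rw [hp.2] at h1
      rw [hq.2] at h2
      exact abs_sub_le_of_mem_Icc_div h1 h2
  exact ⟨x, hx.1, y, hy.1, z, hz.1, hxy, hxz, hyz, close y x hy hx, close z x hz hx⟩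

theorem norm_le_two_mul {x : EuclideanSpace ℝ (Fin 4)} {r : ℝ} (h : ∀ i, |x i| ≤ r) :
    ‖x‖ ≤ 2 * r := by
  have hr : 0 ≤ r := (abs_nonneg _).trans (h 0)
  rw [EuclideanSpace.norm_eq]
  refine Real.sqrt_le_iff.2 ⟨by positivity, ?_⟩
  calc ∑ i, ‖x i‖ ^ 2 ≤ ∑ _i : Fin 4, r ^ 2 := by
        gcongr with i
        exact h i
    _ = (2 * r) ^ 2 := by simp; ring

/-- The area spanned by two plane vectors is at most the product of the norms and the difference
of the arguments. -/
theorem abs_area_le_mul_abs_arg_sub (p q : ℂ) :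
    |p.re * q.im - p.im * q.re| ≤ ‖p‖ * ‖q‖ * |q.arg - p.arg| := by
  have h : p.re * q.im - p.im * q.re = ‖p‖ * ‖q‖ * Real.sin (q.arg - p.arg) := by
    rw [Real.sin_sub]
    linear_combination
      -q.im * Complex.norm_mul_cos_arg p - ‖p‖ * Real.cos p.arg * Complex.norm_mul_sin_arg q +
      q.re * Complex.norm_mul_sin_arg p + ‖p‖ * Real.sin p.arg * Complex.norm_mul_cos_arg q
  rw [h, abs_mul, abs_of_nonneg (mul_nonneg (norm_nonneg p) (norm_nonneg q))]
  exact mul_le_mul_of_nonneg_left Real.abs_sin_le_abs (by positivity)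

/-- Two of more than `k` plane vectors have arguments differing by at most `2 * π / k`. -/
theorem exists_abs_arg_sub_le {α : Type*} {k : ℕ} (hk : 0 < k) {Y : Finset α}
    (hY : k < Y.card) (p : α → ℂ) :
    ∃ y ∈ Y, ∃ z ∈ Y, y ≠ z ∧ |(p z).arg - (p y).arg| ≤ 2 * Real.pi / k := by
  have hpi := Real.pi_pos
  have key : ∀ y, ∃ j < k, ((p y).arg + Real.pi) / (2 * Real.pi) ∈
      Set.Icc ((j : ℝ) / k) ((j + 1) / k) := fun y => by
    refine exists_nat_lt_mem_Icc_div hk ⟨?_, ?_⟩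
    · have := Complex.neg_pi_lt_arg (p y)
      exact div_nonneg (by linarith) (by positivity)
    · have := Complex.arg_le_pi (p y)
      rw [div_le_one (by positivity)]
      linarith
  choose f hfk hf using key
  obtain ⟨y, hy, z, hz, hne, hyz⟩ := Finset.exists_ne_map_eq_of_card_lt_of_maps_to
    (s := Y) (t := Finset.range k) (f := f) (by simpa using hY)
    (fun y _ => by simpa using hfk y)
  refine ⟨y, hy, z, hz, hne, ?_⟩
  have h := abs_sub_le_of_mem_Icc_div (hf z) (hyz ▸ hf y)
  rw [← sub_div, add_sub_add_right_eq_sub, abs_div, abs_of_pos (by positivity : 0 < 2 * Real.pi),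
    div_le_iff₀ (by positivity)] at h
  linarith [show 1 / (k : ℝ) * (2 * Real.pi) = 2 * Real.pi / k by ring]

theorem simplexVol_four (p : Fin 5 → EuclideanSpace ℝ (Fin 4)) :
    simplexVol p = 24⁻¹ * vol ![p 1 - p 0, p 2 - p 0, p 3 - p 0, p 4 - p 0] := by
  have h : (fun i : Fin 4 => p i.succ - p 0) =
      ![p 1 - p 0, p 2 - p 0, p 3 - p 0, p 4 - p 0] := by
    ext i : 1
    fin_cases i <;> rfl
  rw [simplexVol, h]
  norm_num [Nat.factorial]

theorem minSimplexVol_le {d k : ℕ} {X : Finset (EuclideanSpace ℝ (Fin d))}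
    {p : Fin (k + 1) → EuclideanSpace ℝ (Fin d)} (hp : Function.Injective p)
    (hpX : ∀ i, p i ∈ X) : minSimplexVol d k X ≤ simplexVol p := by
  refine csInf_le ⟨0, ?_⟩ ⟨p, hp, hpX, rfl⟩
  rintro _ ⟨q, -, -, rfl⟩
  exact mul_nonneg (by positivity) (Real.sqrt_nonneg _)

/-- A small triangle is completed to a simplex by two points that are seen from it, in the
orthogonal plane, in almost the same direction. -/
theorem minSimplexVol_four_le {m n : ℕ} (hm : 0 < m) (hn : 5 ≤ n) (hmn : 2 * m ^ 4 < n)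
    {X : Finset (EuclideanSpace ℝ (Fin 4))} (hXn : X.card = n)
    (hX : ∀ x ∈ X, ∀ i, x i ∈ Set.Icc (0 : ℝ) 1) :
    minSimplexVol 4 4 X ≤ 16 / 3 * Real.pi / (m ^ 2 * (n - 4 : ℕ)) := by
  classical
  obtain ⟨x, hx, y, hy, z, hz, hxy, hxz, hyz, hyx', hzx'⟩ :=
    exists_three_close hm hX (hXn ▸ hmn)
  have hyx : ‖y - x‖ ≤ 2 * (1 / m) := norm_le_two_mul hyx'
  have hzx : ‖z - x‖ ≤ 2 * (1 / m) := norm_le_two_mul hzx'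
  obtain ⟨a, b, ha, hb, hvol⟩ := exists_vol_le_norm_mul_norm_mul (y - x) (z - x)
  set Y := X \ {x, y, z} with hYdef
  have hY : n - 4 < Y.card := by
    have h1 := Finset.le_card_sdiff {x, y, z} X
    have h2 := Finset.card_le_three (a := x) (b := y) (c := z)
    rw [hYdef]
    omega
  obtain ⟨s, hs, t, ht, hst, harg⟩ := exists_abs_arg_sub_le (by omega) hY
    fun p => (⟨⟪p - x, a⟫, ⟪p - x, b⟫⟩ : ℂ)
  have hn4 : (0 : ℝ) < (n - 4 : ℕ) := by
    have : 0 < n - 4 := by omega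
    exact_mod_cast this
  have hm' : (0 : ℝ) < m := by exact_mod_cast hm
  have hnorm : ∀ p ∈ X, ‖(⟨⟪p - x, a⟫, ⟪p - x, b⟫⟩ : ℂ)‖ ≤ 4 := fun p hp => by
    have h2 : ‖p - x‖ ≤ 2 * 1 := norm_le_two_mul fun i => by
      have h1 := hX p hp i
      have h2 := hX x hx i
      simpa using abs_sub_le_of_le_of_le h1.1 h1.2 h2.1 h2.2
    have hpa := abs_real_inner_le_norm (p - x) a
    have hpb := abs_real_inner_le_norm (p - x) b
    have := Complex.norm_le_abs_re_add_abs_im (⟨⟪p - x, a⟫, ⟪p - x, b⟫⟩ : ℂ)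
    rw [ha] at hpa
    rw [hb] at hpb
    linarith
  simp only [hYdef, Finset.mem_sdiff, Finset.mem_insert, Finset.mem_singleton, not_or] at hs ht
  have harea : |⟪s - x, a⟫ * ⟪t - x, b⟫ - ⟪s - x, b⟫ * ⟪t - x, a⟫| ≤
      4 * 4 * (2 * Real.pi / (n - 4 : ℕ)) := by
    refine (abs_area_le_mul_abs_arg_sub ⟨⟪s - x, a⟫, ⟪s - x, b⟫⟩
      ⟨⟪t - x, a⟫, ⟪t - x, b⟫⟩).trans ?_
    gcongr
    exacts [hnorm s hs.1, hnorm t ht.1]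
  have hinj : Function.Injective ![x, y, z, s, t] := by
    obtain ⟨-, hs1, hs2, hs3⟩ := hs
    obtain ⟨-, ht1, ht2, ht3⟩ := ht
    intro i j
    fin_cases i <;> fin_cases j <;> simp_all [eq_comm]
  have hmem : ∀ i, ![x, y, z, s, t] i ∈ X := by
    intro i
    fin_cases i
    exacts [hx, hy, hz, hs.1, ht.1]
  calc minSimplexVol 4 4 X ≤ simplexVol ![x, y, z, s, t] := minSimplexVol_le hinj hmem
    _ = 24⁻¹ * vol ![y - x, z - x, s - x, t - x] := simplexVol_four _
    _ ≤ 24⁻¹ * (2 * (1 / m) * (2 * (1 / m)) * (4 * 4 * (2 * Real.pi / (n - 4 : ℕ)))) := by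
        refine mul_le_mul_of_nonneg_left ((hvol _ _).trans ?_) (by norm_num)
        gcongr
    _ = 16 / 3 * Real.pi / (m ^ 2 * (n - 4 : ℕ)) := by
        field_simp
        norm_num

theorem exists_two_mul_pow_four_lt {n : ℕ} (hn : 3 ≤ n) :
    ∃ m : ℕ, 0 < m ∧ 2 * m ^ 4 < n ∧ n ≤ 32 * m ^ 4 := by
  have hex : ∃ m : ℕ, n ≤ 2 * (m + 1) ^ 4 :=
    ⟨n, by nlinarith [Nat.le_self_pow (n := 4) (by norm_num) (n + 1)]⟩
  classical
  have hspec := Nat.find_spec hex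
  have hpos : 0 < Nat.find hex := (Nat.find_pos hex).2 (by omega)
  have hmin := Nat.find_min hex (m := Nat.find hex - 1) (by omega)
  rw [Nat.sub_add_cancel hpos] at hmin
  refine ⟨Nat.find hex, hpos, by omega, hspec.trans ?_⟩
  calc 2 * (Nat.find hex + 1) ^ 4 ≤ 2 * (2 * Nat.find hex) ^ 4 := by
        gcongr
        omega
    _ = 32 * Nat.find hex ^ 4 := by ring

/-- **Corollary 2 (case d = 4).** There is a constant `C > 0` such that for every
`n ≥ 5` one has `Δ_{4,4}(n) ≤ C · n^(-(3/2))`: every `n`-element subset of `[0,1]^4`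
contains 5 points spanning a simplex of 4-dimensional volume at most `C · n^(-(3/2))`. -/
theorem delta_four_four :
    ∃ C : ℝ, 0 < C ∧ ∀ n : ℕ, 5 ≤ n →
      Delta 4 4 n ≤ C * (n : ℝ) ^ ((-(3/2) : ℝ)) := by
  refine ⟨160 * Real.pi, by positivity, fun n hn => ?_⟩
  have hn0 : (0 : ℝ) < n := by
    have : 0 < n := by omega
    exact_mod_cast this
  refine Real.sSup_le ?_ (by positivity)
  rintro _ ⟨X, hXn, hX, rfl⟩
  obtain ⟨m, hm, hmn, hnm⟩ := exists_two_mul_pow_four_lt (n := n) (by omega)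
  refine (minSimplexVol_four_le hm hn hmn hXn hX).trans ?_
  have hn4 : (n : ℝ) / 5 ≤ (n - 4 : ℕ) := by
    rw [Nat.cast_sub (by omega)]
    have : (5 : ℝ) ≤ n := by exact_mod_cast hn
    push_cast
    linarith
  have hsqrt : Real.sqrt n / 6 ≤ (m : ℝ) ^ 2 := by
    have h : (n : ℝ) ≤ 32 * m ^ 4 := by exact_mod_cast hnm
    have : Real.sqrt n ≤ 6 * (m : ℝ) ^ 2 :=
      Real.sqrt_le_iff.2 ⟨by positivity, by nlinarith [sq_nonneg ((m : ℝ) ^ 2)]⟩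
    linarith
  have hpow : (n : ℝ) ^ (-(3 / 2) : ℝ) = 1 / (Real.sqrt n * n) := by
    rw [Real.rpow_neg hn0.le, Real.sqrt_eq_rpow, ← Real.rpow_add_one hn0.ne', one_div]
    norm_num
  rw [hpow]
  calc 16 / 3 * Real.pi / ((m : ℝ) ^ 2 * (n - 4 : ℕ))
      ≤ 16 / 3 * Real.pi / (Real.sqrt n / 6 * (n / 5)) := by gcongr
    _ = 160 * Real.pi * (1 / (Real.sqrt n * n)) := by
        field_simp
        norm_num
end
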